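/- Let X = (X₀, X₁, …) be a sequence of S-valued random variables and let ξ = (ξ₀, ξ₁, …) be a product disintegration of X which is stationary, i.e. for every k ∈ ℕ the shifted sequence (ξ_k, ξ_{k+1}, …) has the same law (as a random element of M₁(S)^ℕ) as (ξ₀, ξ₁, …). Then X is a stationary sequence: for every k ∈ ℕ, the sequence (X_k, X_{k+1}, …) has the same law (as a random element of S^ℕ) as (X₀, X₁, …). -/

import Mathlib

open MeasureTheory ProbabilityTheory Filter

noncomputable section

/-- The σ-algebra generated by a sequence of random (probability) measures. -/
def sigmaGen {Ω S : Type*} [MeasurableSpace S] (ξ : ℕ → Ω → Measure S) :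
    MeasurableSpace Ω :=
  ⨆ n, MeasurableSpace.comap (ξ n) inferInstance

/-- `ξ` is a product disintegration of `X`: each `ξ n` is a random probability measure on `S`,
each `X n` is a random variable, and for every `n` and Borel sets `A 0, …, A n`, almost surely
`𝔼[𝟙{X₀∈A₀} ⋯ 𝟙{Xₙ∈Aₙ} | σ(ξ)] = ξ₀(A₀) ⋯ ξₙ(Aₙ)`. -/
def IsProductDisintegration {Ω S : Type*} [MeasurableSpace Ω] [MeasurableSpace S]
    (P : Measure Ω) (X : ℕ → Ω → S) (ξ : ℕ → Ω → Measure S) : Prop :=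
  (∀ n, Measurable (X n)) ∧ (∀ n, Measurable (ξ n)) ∧
    (∀ n ω, IsProbabilityMeasure (ξ n ω)) ∧
    ∀ (n : ℕ) (A : Fin (n + 1) → Set S), (∀ i, MeasurableSet (A i)) →
      (P[(fun ω => ∏ i : Fin (n + 1), (A i).indicator (fun _ => (1 : ℝ)) (X i ω)) | sigmaGen ξ])
        =ᵐ[P] fun ω => ∏ i : Fin (n + 1), (ξ i ω (A i)).toReal


section

variable {Ω S : Type*} [MeasurableSpace Ω] [MeasurableSpace S]

theorem sigmaGen_le {ξ : ℕ → Ω → Measure S} (hξ : ∀ n, Measurable (ξ n)) :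
    sigmaGen ξ ≤ ‹MeasurableSpace Ω› :=
  iSup_le fun n => (hξ n).comap_le

/-- The finite-dimensional laws of `X` are the averages of the products of the `ξ i`. -/
theorem IsProductDisintegration.measureReal_cylinder {P : Measure Ω} [IsProbabilityMeasure P]
    {X : ℕ → Ω → S} {ξ : ℕ → Ω → Measure S} (h : IsProductDisintegration P X ξ)
    (n : ℕ) {A : ℕ → Set S} (hA : ∀ i, MeasurableSet (A i)) :
    P.real {ω | ∀ i < n + 1, X i ω ∈ A i} =
      ∫ ω, ∏ i ∈ Finset.range (n + 1), (ξ i ω (A i)).toReal ∂P := by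
  obtain ⟨hX, hξ, -, hd⟩ := h
  have hmeas : MeasurableSet {ω | ∀ i < n + 1, X i ω ∈ A i} := by
    simp only [Set.ofPred_forall]
    exact .iInter fun i => .iInter fun _ => hX i (hA i)
  have hprod : (fun ω => ∏ i : Fin (n + 1), (A i).indicator (fun _ => (1 : ℝ)) (X i ω)) =
      {ω | ∀ i < n + 1, X i ω ∈ A i}.indicator 1 := by
    classical
    ext ω
    simp only [Set.indicator_apply, Set.mem_ofPred_eq, Pi.one_apply]
    rw [Finset.prod_ite_zero]
    simp [Fin.forall_iff]
  rw [← integral_indicator_one hmeas, ← hprod, ← integral_condExp (sigmaGen_le hξ)]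
  refine integral_congr_ae ((hd n (fun i => A i) fun i => hA i).trans (.of_forall fun ω => ?_))
  exact Fin.prod_univ_eq_prod_range (fun i => (ξ i ω (A i)).toReal) (n + 1)

/-- The finite-dimensional laws of the shifts of `X` are the averages of the products of the
shifted `ξ i`. -/
theorem IsProductDisintegration.measureReal_cylinder_shift {P : Measure Ω}
    [IsProbabilityMeasure P] {X : ℕ → Ω → S} {ξ : ℕ → Ω → Measure S}
    (h : IsProductDisintegration P X ξ) (k n : ℕ) {A : ℕ → Set S}
    (hA : ∀ i, MeasurableSet (A i)) :
    P.real {ω | ∀ i < n + 1, X (i + k) ω ∈ A i} =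
      ∫ ω, ∏ i ∈ Finset.range (n + 1), (ξ (i + k) ω (A i)).toReal ∂P := by
  have := h.2.2.1
  let B : ℕ → Set S := fun j => if j < k then Set.univ else A (j - k)
  have hB : ∀ j, MeasurableSet (B j) := fun j => by
    by_cases hj : j < k <;> simp [B, hj, hA]
  have hset : {ω | ∀ i < n + 1, X (i + k) ω ∈ A i} = {ω | ∀ j < k + n + 1, X j ω ∈ B j} := by
    ext ω
    refine ⟨fun hω j hj => ?_, fun hω i hi => ?_⟩
    · by_cases hjk : j < k
      · simp [B, hjk]
      · have := hω (j - k) (by lia)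
        rw [Nat.sub_add_cancel (by lia)] at this
        simpa [B, hjk] using this
    · simpa [B] using hω (i + k) (by lia)
  rw [hset, h.measureReal_cylinder (k + n) hB]
  refine integral_congr_ae (.of_forall fun ω => ?_)
  have hfst : ∏ j ∈ Finset.range k, (ξ j ω (B j)).toReal = 1 :=
    Finset.prod_eq_one fun j hj => by simp [B, Finset.mem_range.1 hj]
  simp only [add_assoc, Finset.prod_range_add, hfst, one_mul]
  simp [B, add_comm k]

/-- Finite measures on a sequence space agree if they agree on initial rectangles. -/
theorem ext_of_initial_rectangles {μ ν : Measure (ℕ → S)} [IsFiniteMeasure μ]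
    (h : ∀ (n : ℕ) (A : ℕ → Set S), (∀ i, MeasurableSet (A i)) →
      μ {x | ∀ i < n + 1, x i ∈ A i} = ν {x | ∀ i < n + 1, x i ∈ A i}) : μ = ν := by
  classical
  refine ext_of_generate_finite _ (generateFrom_squareCylinders (α := fun _ : ℕ => S)).symm
    (isPiSystem_squareCylinders (fun _ => MeasurableSpace.isPiSystem_measurableSet)
      fun _ => MeasurableSet.univ) ?_ ?_
  · rintro _ ⟨s, t, ht, rfl⟩
    have hst : (s : Set ℕ).pi t =
        {x | ∀ i < s.sup id + 1, x i ∈ if i ∈ s then t i else Set.univ} := by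
      ext x
      refine ⟨fun hx i _ => ?_, fun hx i hi => ?_⟩
      · split_ifs with his
        exacts [hx i his, Set.mem_univ _]
      · have hi' : i ∈ s := hi
        simpa [hi'] using hx i (Nat.lt_succ_of_le (Finset.le_sup (f := id) hi'))
    rw [hst]
    refine h _ _ fun i => ?_
    split_ifs
    exacts [ht i (Set.mem_univ i), MeasurableSet.univ]
  · simpa using h 0 (fun _ => Set.univ) fun _ => MeasurableSet.univ

end

/-- A stationary product disintegration yields a stationary sequence `X`. -/
theorem statement16
    {Ω : Type*} [MeasurableSpace Ω] (P : Measure Ω) [IsProbabilityMeasure P]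
    {S : Type*} [TopologicalSpace S] [CompactSpace S] [TopologicalSpace.MetrizableSpace S]
    [MeasurableSpace S] [BorelSpace S]
    (X : ℕ → Ω → S) (ξ : ℕ → Ω → Measure S)
    (hdis : IsProductDisintegration P X ξ)
    (hstat : ∀ k : ℕ,
      Measure.map (fun ω => (fun i : ℕ => ξ (i + k) ω)) P =
        Measure.map (fun ω => (fun i : ℕ => ξ i ω)) P) :
    ∀ k : ℕ,
      Measure.map (fun ω => (fun i : ℕ => X (i + k) ω)) P =
        Measure.map (fun ω => (fun i : ℕ => X i ω)) P := by
  intro k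
  obtain ⟨hX, hξ, -, -⟩ := id hdis
  have hXk : Measurable fun ω => fun i : ℕ => X (i + k) ω := measurable_pi_lambda _ fun i => hX _
  have hX0 : Measurable fun ω => fun i : ℕ => X i ω := measurable_pi_lambda _ hX
  have hξk : Measurable fun ω => fun i : ℕ => ξ (i + k) ω := measurable_pi_lambda _ fun i => hξ _
  have hξ0 : Measurable fun ω => fun i : ℕ => ξ i ω := measurable_pi_lambda _ hξ
  have := Measure.isProbabilityMeasure_map (μ := P) hXk.aemeasurable
  refine ext_of_initial_rectangles fun n A hA => ?_
  have hmeas : MeasurableSet {x : ℕ → S | ∀ i < n + 1, x i ∈ A i} := by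
    simp only [Set.ofPred_forall]
    exact .iInter fun i => .iInter fun _ => measurable_pi_apply i (hA i)
  have hφ : Measurable fun m : ℕ → Measure S =>
      ∏ i ∈ Finset.range (n + 1), (m i (A i)).toReal :=
    Finset.measurable_fun_prod _ fun i _ =>
      ((Measure.measurable_coe (hA i)).comp (measurable_pi_apply i)).ennreal_toReal
  rw [Measure.map_apply hXk hmeas, Measure.map_apply hX0 hmeas, ← measureReal_eq_measureReal_iff]
  refine (hdis.measureReal_cylinder_shift k n hA).trans
    (Eq.trans ?_ (hdis.measureReal_cylinder n hA).symm)
  rw [← integral_map hξk.aemeasurable hφ.aestronglyMeasurable, hstat k,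
    integral_map hξ0.aemeasurable hφ.aestronglyMeasurable]
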